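/- Let H be a real separable Hilbert space, let σ : H → H be measurable with |σ(z)|_H ≤ C(1 + |z|_H) for all z ∈ H and some constant C, and let f : H → ℝ be twice Fréchet differentiable with second derivative Lipschitz with constant K. Let ν be a σ-finite Borel measure on ℝ \ {0} with ∫_{0<|x|≤1} x² ν(dx) < ∞, set α(ε) = (∫_{0<|x|≤ε} x² ν(dx))^{1/2}, and assume α(ε) > 0 for all ε ∈ (0,1]. Then for every N > 0 there is a constant C_N such that for all ε ∈ (0,1] and all z with |z|_H ≤ N, | ∫_{0<|x|≤ε} [ f(z + (x/α(ε))·σ(z)) − f(z) − f'(z)((x/α(ε))·σ(z)) ] ν(dx) − (1/2) f''(z)(σ(z), σ(z)) | ≤ C_N · ε/α(ε). -/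

import Mathlib

open MeasureTheory Filter Topology Set

/-- Taylor's formula of order two, with cubic remainder, for a function with Lipschitz second
derivative. -/
theorem abs_taylor_two_remainder_le {E : Type*} [NormedAddCommGroup E] [NormedSpace ℝ E]
    {f : E → ℝ} (hf : ContDiff ℝ 2 f) {K : NNReal}
    (hK : LipschitzWith K (fun z => fderiv ℝ (fderiv ℝ f) z)) (z h : E) :
    |f (z + h) - f z - fderiv ℝ f z h - (1 / 2) * fderiv ℝ (fderiv ℝ f) z h h|
      ≤ K * ‖h‖ ^ 3 := by
  have hd : Differentiable ℝ f := hf.differentiable (by norm_num)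
  have hd' : Differentiable ℝ (fderiv ℝ f) :=
    (hf.fderiv_right (m := 1) (by norm_num)).differentiable (by norm_num)
  have first_order : ∀ t ∈ Icc (0 : ℝ) 1,
      ‖fderiv ℝ f (z + t • h) - fderiv ℝ f z - fderiv ℝ (fderiv ℝ f) z (t • h)‖
        ≤ K * ‖h‖ * ‖h‖ := by
    intro t ht
    have hth : ‖t • h‖ ≤ ‖h‖ := by
      rw [norm_smul, Real.norm_eq_abs, abs_of_nonneg ht.1]
      exact mul_le_of_le_one_left (norm_nonneg h) ht.2
    have := (convex_closedBall z ‖h‖).norm_image_sub_le_of_norm_hasFDerivWithin_le'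
      (f := fderiv ℝ f) (f' := fderiv ℝ (fderiv ℝ f)) (φ := fderiv ℝ (fderiv ℝ f) z)
      (C := K * ‖h‖) (x := z) (y := z + t • h)
      (fun x _ => (hd' x).hasFDerivAt.hasFDerivWithinAt)
      (fun x hx => by
        refine (hK.norm_sub_le x z).trans ?_
        gcongr
        simpa [dist_eq_norm] using hx)
      (by simp) (by simpa using hth)
    rw [add_sub_cancel_left] at this
    refine this.trans ?_
    gcongr
  have hline : ∀ t : ℝ, HasDerivAt (fun s : ℝ => z + s • h) h t := fun t => by
    simpa using ((hasDerivAt_id t).smul_const h).const_add z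
  have hφ : ∀ t : ℝ, HasDerivAt
      (fun s : ℝ => f (z + s • h) - f z - s * fderiv ℝ f z h
        - s ^ 2 * ((1 / 2) * fderiv ℝ (fderiv ℝ f) z h h))
      ((fderiv ℝ f (z + t • h) - fderiv ℝ f z - fderiv ℝ (fderiv ℝ f) z (t • h)) h) t := by
    intro t
    have h1 := (hd (z + t • h)).hasFDerivAt.comp_hasDerivAt t (hline t)
    have h2 := (hasDerivAt_id t).mul_const (fderiv ℝ f z h)
    have h3 := ((hasDerivAt_id t).pow 2).mul_const ((1 / 2) * fderiv ℝ (fderiv ℝ f) z h h)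
    refine (((h1.sub_const (f z)).sub h2).sub h3).congr_deriv ?_
    simp
    ring
  have := (convex_Icc (0 : ℝ) 1).norm_image_sub_le_of_norm_hasDerivWithin_le
    (C := K * ‖h‖ ^ 3) (x := 0) (y := 1)
    (fun t _ => (hφ t).hasDerivWithinAt)
    (fun t ht => by
      refine (ContinuousLinearMap.le_opNorm _ h).trans ?_
      calc _ ≤ K * ‖h‖ * ‖h‖ * ‖h‖ := by gcongr; exact first_order t ht
        _ = K * ‖h‖ ^ 3 := by ring)
    (by simp) (by simp)
  simpa using this

/-- Quantitative generator estimate (estimate (5.20) of the paper): with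
`α(ε) = (∫_{0<|x|≤ε} x² ν(dx))^{1/2}`, for every `N > 0` there is a constant
`C_N` such that for all `ε ∈ (0,1]` and all `z` with `‖z‖ ≤ N`,
`| ∫_{0<|x|≤ε} [f(z + (x/α(ε))σ(z)) - f(z) - f'(z)((x/α(ε))σ(z))] ν(dx)
   - (1/2) f''(z)(σ(z), σ(z)) | ≤ C_N · ε/α(ε)`. -/
theorem generator_difference_quantitative_bound
    {H : Type*} [NormedAddCommGroup H] [InnerProductSpace ℝ H] [CompleteSpace H]
    [SecondCountableTopology H] [MeasurableSpace H] [BorelSpace H]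
    (σ : H → H) (hσ_meas : Measurable σ)
    (C : ℝ) (hσ_growth : ∀ z : H, ‖σ z‖ ≤ C * (1 + ‖z‖))
    (f : H → ℝ) (hf : ContDiff ℝ 2 f)
    (K : NNReal) (hf'' : LipschitzWith K (fun z => fderiv ℝ (fderiv ℝ f) z))
    (ν : Measure ℝ) [SigmaFinite ν] (hν0 : ν {0} = 0)
    (hν_int : IntegrableOn (fun x : ℝ => x ^ 2) {x : ℝ | 0 < |x| ∧ |x| ≤ 1} ν)
    (α : ℝ → ℝ)
    (hα : ∀ ε : ℝ,
      α ε = Real.sqrt (∫ x in {x : ℝ | 0 < |x| ∧ |x| ≤ ε}, x ^ 2 ∂ν))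
    (hα_pos : ∀ ε ∈ Set.Ioc (0:ℝ) 1, 0 < α ε) :
    ∀ N : ℝ, 0 < N → ∃ C_N : ℝ, ∀ ε ∈ Set.Ioc (0:ℝ) 1, ∀ z : H, ‖z‖ ≤ N →
      |(∫ x in {x : ℝ | 0 < |x| ∧ |x| ≤ ε},
            (f (z + (x / α ε) • σ z) - f z - fderiv ℝ f z ((x / α ε) • σ z)) ∂ν)
          - (1/2) * fderiv ℝ (fderiv ℝ f) z (σ z) (σ z)|
        ≤ C_N * (ε / α ε) := by
  intro N hN
  refine ⟨K * (|C| * (1 + N)) ^ 3, fun ε hε z hz => ?_⟩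
  set S : Set ℝ := {x : ℝ | 0 < |x| ∧ |x| ≤ ε} with hS
  have ha : 0 < α ε := hα_pos ε hε
  have hσz : ‖σ z‖ ≤ |C| * (1 + N) := by
    refine (hσ_growth z).trans ?_
    gcongr
    exact le_abs_self C
  have hS_meas : MeasurableSet S :=
    (measurableSet_lt measurable_const measurable_id.abs).inter
      (measurableSet_le measurable_id.abs measurable_const)
  have hsq_int : IntegrableOn (fun x : ℝ => x ^ 2) S ν :=
    hν_int.mono_set fun x hx => ⟨hx.1, hx.2.trans hε.2⟩
  have hsq : ∫ x in S, x ^ 2 ∂ν = α ε ^ 2 := by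
    rw [hα ε, Real.sq_sqrt (integral_nonneg fun x => sq_nonneg x)]
  set B : ℝ := fderiv ℝ (fderiv ℝ f) z (σ z) (σ z) with hB
  let F : ℝ → ℝ := fun x =>
    f (z + (x / α ε) • σ z) - f z - fderiv ℝ f z ((x / α ε) • σ z)
  let Q : ℝ → ℝ := fun x => (1 / 2 * B / α ε ^ 2) * x ^ 2
  let D : ℝ := K * (|C| * (1 + N)) ^ 3 * ε / α ε ^ 3
  have hQ_int : IntegrableOn Q S ν := hsq_int.const_mul _
  have hD_int : IntegrableOn (fun x => D * x ^ 2) S ν := hsq_int.const_mul _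
  have hbound : ∀ᵐ x ∂ν.restrict S, ‖F x - Q x‖ ≤ D * x ^ 2 := by
    filter_upwards [ae_restrict_mem hS_meas] with x hx
    have hT := abs_taylor_two_remainder_le hf hf'' z ((x / α ε) • σ z)
    have hQx : 1 / 2 * fderiv ℝ (fderiv ℝ f) z ((x / α ε) • σ z) ((x / α ε) • σ z) = Q x := by
      simp only [map_smul, smul_apply, smul_eq_mul, Q, hB]
      field_simp
    rw [hQx] at hT
    refine hT.trans ?_
    rw [norm_smul, Real.norm_eq_abs, abs_div, abs_of_pos ha]
    calc (K : ℝ) * (|x| / α ε * ‖σ z‖) ^ 3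
        = K * ‖σ z‖ ^ 3 * |x| / α ε ^ 3 * |x| ^ 2 := by field_simp
      _ ≤ K * (|C| * (1 + N)) ^ 3 * ε / α ε ^ 3 * |x| ^ 2 := by
          gcongr
          exact hx.2
      _ = D * x ^ 2 := by rw [sq_abs]
  have hf_cont : Continuous f := hf.continuous
  have hF_cont : Continuous F := by fun_prop
  have hQ_cont : Continuous Q := by fun_prop
  have hR_int : IntegrableOn (fun x => F x - Q x) S ν :=
    hD_int.mono' (hF_cont.sub hQ_cont).aestronglyMeasurable hbound
  have hF_int : IntegrableOn F S ν :=
    (Integrable.add hR_int hQ_int).congr (ae_of_all _ fun x => sub_add_cancel (F x) (Q x))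
  have hQ_eq : ∫ x in S, Q x ∂ν = 1 / 2 * B := by
    rw [integral_const_mul, hsq]
    field_simp
  calc |(∫ x in S, F x ∂ν) - 1 / 2 * B|
      = ‖∫ x in S, (F x - Q x) ∂ν‖ := by
        rw [integral_sub hF_int hQ_int, hQ_eq, Real.norm_eq_abs]
    _ ≤ ∫ x in S, D * x ^ 2 ∂ν := norm_integral_le_of_norm_le hD_int hbound
    _ = K * (|C| * (1 + N)) ^ 3 * (ε / α ε) := by
        rw [integral_const_mul, hsq]
        simp only [D]
        field_simp
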